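/- There is a universal constant C > 0 such that for every ε ∈ (0,1), every MHR value distribution D, and every integer m ≥ C·ε^{−3/2}·log(1/ε), the (1/e)-guarded empirical reserve price computed from m i.i.d. samples from D has expected revenue at least (1−ε)·R*, where R* = max_p p·(1−F(p)) is the optimal revenue of D and the expectation is over the m samples and a fresh buyer value drawn from D. -/

import Mathlib

open MeasureTheory Set

/-- A value distribution on `[0,∞)` with CDF `F`, density `f` (w.r.t. Lebesgue measure),
whose support is an interval contained in `[0,∞)`. -/
structure ValueDist where
  μ : Measure ℝ
  isProb : IsProbabilityMeasure μ
  f : ℝ → ℝ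
  f_nonneg : ∀ x, 0 ≤ f x
  f_meas : Measurable f
  density_eq : μ = volume.withDensity fun x => ENNReal.ofReal (f x)
  supp : Set ℝ
  supp_subset : supp ⊆ Ici 0
  supp_conn : supp.OrdConnected
  f_pos : ∀ x ∈ supp, 0 < f x
  f_zero : ∀ x ∉ supp, f x = 0

/-- The CDF of a value distribution. -/
noncomputable def ValueDist.F (D : ValueDist) (x : ℝ) : ℝ := (D.μ (Iic x)).toReal

/-- The virtual value function `φ(v) = v - (1 - F v) / f v`. -/
noncomputable def ValueDist.phi (D : ValueDist) (x : ℝ) : ℝ := x - (1 - D.F x) / D.f x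

/-- Monotone hazard rate: the virtual value satisfies `dφ/dv ≥ 1` throughout the support. -/
def ValueDist.IsMHR (D : ValueDist) : Prop :=
  ∀ x ∈ D.supp, ∃ d : ℝ, 1 ≤ d ∧ HasDerivWithinAt D.phi d D.supp x

/-- Number of samples with value at least `t` (the empirical sale count of price `t`). -/
noncomputable def empCount {m : ℕ} (s : Fin m → ℝ) (t : ℝ) : ℕ := {j | t ≤ s j}.ncard

/-- `r` is a `c`-guarded empirical reserve for the samples `s`: it is a sample value,
its empirical sale count is at least `c * m` (i.e. its rank, in the sorted order
`v₁ ≥ v₂ ≥ … ≥ v_m`, is at least `c * m`), and it maximizes the empirical revenue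
`i * v_i` among all such sample values. -/
def IsGuardedEmpiricalReserve {m : ℕ} (c : ℝ) (s : Fin m → ℝ) (r : ℝ) : Prop :=
  (∃ i, r = s i) ∧ c * m ≤ (empCount s r : ℝ) ∧
    ∀ i : Fin m, c * m ≤ (empCount s (s i) : ℝ) →
      s i * (empCount s (s i) : ℝ) ≤ r * (empCount s r : ℝ)

namespace ValueDist

/-- survival function -/
noncomputable def q (D : ValueDist) (x : ℝ) : ℝ := 1 - D.F x

variable (D : ValueDist)

lemma noAtoms : NullSingletonClass D.μ := by
  rw [D.density_eq]; infer_instance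

lemma F_eq (x : ℝ) : D.F x = D.μ.real (Iic x) := rfl

lemma q_eq_Ioi (x : ℝ) : D.q x = D.μ.real (Ioi x) := by
  have := D.isProb
  rw [q, F_eq, ← compl_Iic, probReal_compl_eq_one_sub measurableSet_Iic]

lemma q_eq_Ici (x : ℝ) : D.q x = D.μ.real (Ici x) := by
  have := D.noAtoms
  rw [q_eq_Ioi, measureReal_def, measureReal_def, measure_congr Ioi_ae_eq_Ici]

lemma q_nonneg (x : ℝ) : 0 ≤ D.q x := by rw [q_eq_Ioi]; positivity

lemma q_le_one (x : ℝ) : D.q x ≤ 1 := by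
  have := D.isProb
  rw [q_eq_Ioi]; exact measureReal_le_one

lemma q_anti : Antitone D.q := by
  have := D.isProb
  intro x y h
  rw [q_eq_Ioi, q_eq_Ioi]
  exact measureReal_mono (Ioi_subset_Ioi h)

lemma meas_null {s : Set ℝ} (hs : MeasurableSet s) (h : ∀ x ∈ s, x ∉ D.supp) : D.μ s = 0 := by
  rw [D.density_eq, withDensity_apply _ hs]
  rw [setLIntegral_congr_fun (g := fun _ => 0) hs]
  · simp
  · intro x hx
    simp [D.f_zero x (h x hx)]

lemma f_integrable : Integrable D.f := by
  have := D.isProb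
  have h1 : ∫⁻ x, ENNReal.ofReal (D.f x) = 1 := by
    have := measure_univ (μ := D.μ)
    rw [D.density_eq, withDensity_apply _ MeasurableSet.univ] at this
    simpa using this
  refine ⟨D.f_meas.aestronglyMeasurable, ?_⟩
  rw [hasFiniteIntegral_iff_ofReal (Filter.Eventually.of_forall D.f_nonneg), h1]
  simp

lemma F_eq_integral (x : ℝ) : D.F x = ∫ t in Iic x, D.f t := by
  rw [F, D.density_eq, withDensity_apply _ measurableSet_Iic]
  rw [integral_eq_lintegral_of_nonneg_ae (Filter.Eventually.of_forall D.f_nonneg)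
    D.f_meas.aestronglyMeasurable]

lemma F_sub (x y : ℝ) : D.F y - D.F x = ∫ t in x..y, D.f t := by
  rw [F_eq_integral, F_eq_integral]
  exact intervalIntegral.integral_Iic_sub_Iic D.f_integrable.integrableOn D.f_integrable.integrableOn

lemma F_eq_fun : D.F = fun y => D.F 0 + ∫ t in (0:ℝ)..y, D.f t := by
  funext y; rw [← F_sub]; ring

lemma F_cont : Continuous D.F := by
  rw [F_eq_fun]
  exact continuous_const.add (intervalIntegral.continuous_primitive
    (fun a b => D.f_integrable.intervalIntegrable) 0)

lemma q_cont : Continuous D.q := continuous_const.sub D.F_cont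

lemma q_zero : D.q 0 = 1 := by
  have h0 : D.μ (Iio 0) = 0 := D.meas_null measurableSet_Iio
    (fun x hx h => absurd (D.supp_subset h) (by simpa using hx))
  have := D.noAtoms
  rw [q, F, ← measure_congr (Iio_ae_eq_Iic (a := (0:ℝ)) (μ := D.μ)), h0]; simp

lemma q_dichotomy {x : ℝ} (h0 : 0 < D.q x) (h1 : D.q x < 1) : x ∈ interior D.supp := by
  have := D.noAtoms
  by_contra hx
  by_cases hA : ∃ a ∈ D.supp, a < x
  · by_cases hB : ∃ b ∈ D.supp, x < b
    · obtain ⟨a, ha, hax⟩ := hA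
      obtain ⟨b, hb, hbx⟩ := hB
      apply hx
      rw [mem_interior]
      exact ⟨Ioo a b, fun y hy => D.supp_conn.out ha hb ⟨hy.1.le, hy.2.le⟩, isOpen_Ioo, hax, hbx⟩
    · push Not at hB
      have : D.μ (Ioi x) = 0 := D.meas_null measurableSet_Ioi
        (fun y hy h => absurd (hB y h) (by simpa using hy))
      rw [q_eq_Ioi, measureReal_def, this] at h0
      simp at h0
  · push Not at hA
    have : D.μ (Iio x) = 0 := D.meas_null measurableSet_Iio
        (fun y hy h => absurd (hA y h) (by simpa using hy))
    rw [q, F, ← measure_congr (Iio_ae_eq_Iic (a := x) (μ := D.μ)), this] at h1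
    simp at h1

lemma q_pos_of_interior {x : ℝ} (hx : x ∈ interior D.supp) : 0 < D.q x := by
  have := D.isProb
  rw [q_eq_Ioi, measureReal_def, ENNReal.toReal_pos_iff]
  refine ⟨?_, measure_lt_top _ _⟩
  rw [pos_iff_ne_zero]
  intro h
  have h2 : D.μ (Ioi x ∩ interior D.supp) = 0 := measure_mono_null inter_subset_left h
  have hm : MeasurableSet (Ioi x ∩ interior D.supp) :=
    measurableSet_Ioi.inter isOpen_interior.measurableSet
  rw [D.density_eq, withDensity_apply _ hm, setLIntegral_eq_zero_iff hm (by have := D.f_meas; fun_prop)] at h2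
  have h3 : volume (Ioi x ∩ interior D.supp) = 0 := by
    refine measure_mono_null (t := {y | ¬ (y ∈ Ioi x ∩ interior D.supp → ENNReal.ofReal (D.f y) = 0)}) ?_ h2
    intro y hy hc
    have := D.f_pos y (interior_subset hy.2)
    have := hc hy
    rw [ENNReal.ofReal_eq_zero] at this
    linarith
  have ho : IsOpen (Ioi x ∩ interior D.supp) := isOpen_Ioi.inter isOpen_interior
  rw [ho.measure_eq_zero_iff volume] at h3
  have h4 : (Ioi x ∩ interior D.supp).Nonempty := by
    obtain ⟨e, he, hb⟩ := Metric.isOpen_iff.1 isOpen_interior x hx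
    refine ⟨x + e/2, by simp [he], hb ?_⟩
    rw [Metric.mem_ball, Real.dist_eq]
    rw [abs_of_pos] <;> linarith
  rw [h3] at h4
  exact Set.not_nonempty_empty h4

lemma f_cont_interior (hM : D.IsMHR) {x : ℝ} (hx : x ∈ interior D.supp) : ContinuousAt D.f x := by
  obtain ⟨d, -, hd⟩ := hM x (interior_subset hx)
  have hn : D.supp ∈ nhds x := mem_interior_iff_mem_nhds.1 hx
  have h1 : ContinuousAt D.phi x := (hd.hasDerivAt hn).continuousAt
  have hq := D.q_pos_of_interior hx
  have hf := D.f_pos x (interior_subset hx)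
  have h2 : ContinuousAt (fun y => D.q y / (y - D.phi y)) x := by
    refine D.q_cont.continuousAt.div (continuousAt_id.sub h1) ?_
    simp only [phi]
    have : (1 - D.F x) / D.f x > 0 := div_pos hq hf
    simp
    exact ⟨hq.ne', hf.ne'⟩
  refine h2.congr ?_
  filter_upwards [isOpen_interior.mem_nhds hx] with y hy
  have hq := D.q_pos_of_interior hy
  have hf := D.f_pos y (interior_subset hy)
  simp only [phi, sub_sub_cancel]
  change D.q y / (D.q y / D.f y) = _
  field_simp

lemma q_deriv (hM : D.IsMHR) {x : ℝ} (hx : x ∈ interior D.supp) : HasDerivAt D.q (- D.f x) x := by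
  have h1 : HasDerivAt D.F (D.f x) x := by
    rw [F_eq_fun]
    refine HasDerivAt.const_add _ ?_
    exact intervalIntegral.integral_hasDerivAt_right D.f_integrable.intervalIntegrable
      (D.f_meas.stronglyMeasurable.stronglyMeasurableAtFilter) (D.f_cont_interior hM hx)
  exact h1.const_sub 1

lemma supp_convex : Convex ℝ D.supp := D.supp_conn.convex

lemma logq_concave (hM : D.IsMHR) :
    ConcaveOn ℝ (interior D.supp) (fun x => Real.log (D.q x)) := by
  have hder : ∀ x ∈ interior D.supp, HasDerivAt (fun x => Real.log (D.q x)) (- D.f x / D.q x) x :=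
    fun x hx => (D.q_deriv hM hx).log (D.q_pos_of_interior hx).ne'
  have hmono : MonotoneOn (fun x => D.phi x - x) (interior D.supp) := by
    have hd : ∀ x ∈ interior D.supp, ∃ d : ℝ, 0 ≤ d ∧ HasDerivAt (fun x => D.phi x - x) d x := by
      intro x hx
      obtain ⟨d, h1, hd⟩ := hM x (interior_subset hx)
      exact ⟨d - 1, by linarith, (hd.hasDerivAt (mem_interior_iff_mem_nhds.1 hx)).sub (hasDerivAt_id x)⟩
    refine monotoneOn_of_deriv_nonneg D.supp_convex.interior ?_ ?_ ?_
    · intro x hx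
      obtain ⟨d, h1, hd⟩ := hd x hx
      exact hd.continuousAt.continuousWithinAt
    · intro x hx
      rw [interior_interior] at hx
      obtain ⟨d, h1, hd⟩ := hd x hx
      exact hd.differentiableAt.differentiableWithinAt
    · intro x hx
      rw [interior_interior] at hx
      obtain ⟨d, h1, hd⟩ := hd x hx
      rw [hd.deriv]; exact h1
  refine AntitoneOn.concaveOn_of_deriv D.supp_convex.interior ?_ ?_ ?_
  · exact fun x hx => (hder x hx).continuousAt.continuousWithinAt
  · rw [interior_interior]
    exact fun x hx => (hder x hx).differentiableAt.differentiableWithinAt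
  · rw [interior_interior]
    intro x hx y hy hxy
    rw [(hder x hx).deriv, (hder y hy).deriv]
    have h := hmono hx hy hxy
    simp only [phi, sub_sub_cancel_left] at h
    change - (D.q x / D.f x) ≤ - (D.q y / D.f y) at h
    have hqx := D.q_pos_of_interior hx
    have hqy := D.q_pos_of_interior hy
    have hfx := D.f_pos x (interior_subset hx)
    have hfy := D.f_pos y (interior_subset hy)
    rw [neg_le_neg_iff, div_le_div_iff₀ hfy hfx] at h
    rw [neg_div, neg_div, neg_le_neg_iff, div_le_div_iff₀ hqx hqy]
    linarith

lemma exists_q_mem {t : ℝ} (h0 : 0 < t) (h1 : t < 1) : ∃ x, D.q x = t := by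
  have := D.isProb
  have hlim : Filter.Tendsto D.F Filter.atTop (nhds 1) := by
    have := tendsto_measure_Iic_atTop D.μ
    rw [measure_univ] at this
    have h := (ENNReal.tendsto_toReal (by simp)).comp this
    simp only [ENNReal.toReal_one] at h
    exact h
  have : ∃ y, 1 - t < D.F y := (hlim.eventually (lt_mem_nhds (by linarith))).exists
  obtain ⟨y, hy⟩ := this
  exact mem_range_of_exists_le_of_exists_ge D.q_cont ⟨y, by rw [q]; linarith⟩
    ⟨0, by rw [q_zero]; linarith⟩

/-- log-concavity of the survival function -/
lemma q_logconcave (hM : D.IsMHR) {u v a b : ℝ} (ha : 0 < a) (hb : 0 < b) (hab : a + b = 1) :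
    D.q u ^ a * D.q v ^ b ≤ D.q (a * u + b * v) := by
  rcases (D.q_nonneg u).eq_or_lt with hu | hu
  · rw [← hu, Real.zero_rpow ha.ne', zero_mul]; exact D.q_nonneg _
  rcases (D.q_nonneg v).eq_or_lt with hv | hv
  · rw [← hv, Real.zero_rpow hb.ne', mul_zero]; exact D.q_nonneg _
  have key : ∀ t : ℝ, 0 < t → t < 1 → t * (D.q u ^ a * D.q v ^ b) ≤ D.q (a * u + b * v) := by
    intro t ht0 ht1
    obtain ⟨c, rfl⟩ := D.exists_q_mem ht0 ht1
    have hlow : ∀ w, D.q w * D.q c ≤ D.q (max w c) := by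
      intro w
      have h1 := D.q_le_one w
      have h2 := D.q_nonneg w
      rcases max_choice w c with h | h <;> rw [h] <;> nlinarith
    have hin : ∀ w, 0 < D.q w → max w c ∈ interior D.supp := by
      intro w hw
      refine D.q_dichotomy (lt_of_lt_of_le (by positivity) (hlow w)) ?_
      exact lt_of_le_of_lt (D.q_anti (le_max_right w c)) ht1
    have h1 := (D.logq_concave hM).2 (hin u hu) (hin v hv) ha.le hb.le hab
    simp only [smul_eq_mul] at h1
    have hmem : a * max u c + b * max v c ∈ interior D.supp := 
      D.supp_convex.interior (hin u hu) (hin v hv) ha.le hb.le hab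
    have h2 : D.q (a * max u c + b * max v c) ≤ D.q (a * u + b * v) := by
      apply D.q_anti
      have := le_max_left u c
      have := le_max_left v c
      gcongr
    refine le_trans ?_ h2
    have pu := D.q_pos_of_interior (hin u hu)
    have pv := D.q_pos_of_interior (hin v hv)
    have h3 : D.q (max u c) ^ a * D.q (max v c) ^ b ≤ D.q (a * max u c + b * max v c) := by
      rw [← Real.log_le_log_iff (by positivity) (D.q_pos_of_interior hmem),
        Real.log_mul (by positivity) (by positivity), Real.log_rpow pu, Real.log_rpow pv]
      exact h1
    refine le_trans ?_ h3
    have h4 : (D.q u * D.q c) ^ a * (D.q v * D.q c) ^ b ≤ D.q (max u c) ^ a * D.q (max v c) ^ b := by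
      have := hlow u
      have := hlow v
      gcongr
    refine le_trans (le_of_eq ?_) h4
    rw [Real.mul_rpow hu.le ht0.le, Real.mul_rpow hv.le ht0.le]
    have : D.q c = D.q c ^ a * D.q c ^ b := by
      rw [← Real.rpow_add ht0, hab, Real.rpow_one]
    nth_rewrite 1 [this]
    ring
  refine le_of_forall_lt_imp_le_of_dense ?_
  intro z hz
  have hX : 0 < D.q u ^ a * D.q v ^ b := by positivity
  rcases le_or_gt z 0 with hz0 | hz0
  · exact hz0.trans (D.q_nonneg _)
  have := key (z / (D.q u ^ a * D.q v ^ b)) (by positivity) ((div_lt_one hX).2 hz)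
  rwa [div_mul_cancel₀ _ hX.ne'] at this

/-- `p` is a monopoly price. -/
def IsOpt (p : ℝ) : Prop := 0 < p ∧ 0 < D.q p ∧ ∀ x, x * D.q x ≤ p * D.q p

lemma exists_opt (hM : D.IsMHR) : ∃ p, D.IsOpt p := by
  obtain ⟨p1, hp1⟩ := D.exists_q_mem (t := 1/2) (by norm_num) (by norm_num)
  have hp1pos : 0 < p1 := by
    by_contra h
    push Not at h
    have := D.q_anti h
    rw [q_zero, hp1] at this
    norm_num at this
  have hfar : ∀ p, 2 * p1 ≤ p → p * D.q p ≤ p1 * D.q p1 := by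
    intro p hp
    have hp0 : 0 < p := by linarith
    set x := p / p1 with hx
    have hx2 : 2 ≤ x := by rw [hx, le_div_iff₀ hp1pos]; exact hp
    have hx0 : 0 < x := by linarith
    have hpx : p = x * p1 := by rw [hx]; field_simp
    have h := D.q_logconcave hM (u := 0) (v := p) (a := 1 - x⁻¹) (b := x⁻¹)
      (by have : x⁻¹ ≤ 2⁻¹ := by gcongr
          norm_num at this ⊢; linarith) (by positivity) (by ring)
    have e : (1 - x⁻¹) * 0 + x⁻¹ * p = p1 := by rw [hpx]; field_simp; ring
    rw [e, q_zero, Real.one_rpow, one_mul, hp1] at h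
    have h2 : D.q p ≤ (1/2 : ℝ) ^ x := by
      have := Real.rpow_le_rpow (Real.rpow_nonneg (D.q_nonneg p) _) h hx0.le
      rwa [← Real.rpow_mul (D.q_nonneg p), inv_mul_cancel₀ hx0.ne', Real.rpow_one] at this
    have h3 : x ≤ 2 ^ (x - 1) := by
      have := one_add_mul_self_le_rpow_one_add (s := 1) (by norm_num) (p := x - 1) (by linarith)
      norm_num at this
      exact this
    rw [hp1, hpx]
    have h4 : (1/2 : ℝ) ^ x * 2 ^ (x - 1) = 1/2 := by
      rw [Real.rpow_sub_one (by norm_num), one_div, Real.inv_rpow (by norm_num)]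
      have : (0:ℝ) < 2 ^ x := by positivity
      field_simp
    have h5 : x * D.q p ≤ 1/2 := by
      calc x * D.q p ≤ 2 ^ (x-1) * (1/2 : ℝ) ^ x := by
            have := D.q_nonneg p
            gcongr
        _ = 1/2 := by rw [mul_comm]; exact h4
    rw [← hpx]
    calc p * D.q p = p1 * (x * D.q p) := by rw [hpx]; ring
      _ ≤ _ := by gcongr
  obtain ⟨p, hp, hmax⟩ := isCompact_Icc.exists_isMaxOn (s := Icc 0 (2 * p1))
    ⟨p1, hp1pos.le, by linarith⟩ (f := fun x => x * D.q x) (continuous_id.mul D.q_cont).continuousOn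
  have h1 : p1 * D.q p1 ≤ p * D.q p := hmax ⟨hp1pos.le, by linarith⟩
  have hpos : 0 < p * D.q p := lt_of_lt_of_le (by rw [hp1]; positivity) h1
  have hp0 : 0 < p := pos_of_mul_pos_left hpos (D.q_nonneg p)
  refine ⟨p, hp0, pos_of_mul_pos_right hpos hp.1, ?_⟩
  intro x
  rcases lt_or_ge x 0 with hx | hx
  · have := mul_nonneg_of_nonpos_of_nonpos hx.le (neg_nonpos.2 (D.q_nonneg x))
    linarith
  rcases le_or_gt x (2 * p1) with hx2 | hx2
  · exact hmax ⟨hx, hx2⟩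
  · exact (hfar x hx2.le).trans h1

variable {D}

lemma IsOpt.q_upper {p : ℝ} (h : D.IsOpt p) (hM : D.IsMHR) {x : ℝ} (hx : 0 ≤ x) :
    D.q (x * p) ≤ D.q p * Real.exp (1 - x) := by
  obtain ⟨hp, hq, hopt⟩ := h
  rcases (D.q_nonneg (x * p)).eq_or_lt with h0 | h0
  · rw [← h0]; positivity
  suffices hs : x - 1 ≤ Real.log (D.q p) - Real.log (D.q (x * p)) by
    rw [← Real.log_le_log_iff h0 (by positivity), Real.log_mul hq.ne' (Real.exp_pos _).ne',
      Real.log_exp]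
    linarith
  have key : ∀ t ∈ Ioo (0:ℝ) 1, (x - 1) / (1 + t * (x - 1)) ≤
      Real.log (D.q p) - Real.log (D.q (x * p)) := by
    rintro t ⟨ht0, ht1⟩
    have h1 := D.q_logconcave hM (u := p) (v := x * p) (a := 1 - t) (b := t) (by linarith) ht0
      (by ring)
    have e : (1 - t) * p + t * (x * p) = (1 + t * (x - 1)) * p := by ring
    rw [e] at h1
    have hc : 0 < 1 + t * (x - 1) := by nlinarith
    have h2 := hopt ((1 + t * (x - 1)) * p)
    have h3 : (1 + t * (x - 1)) * (D.q p ^ (1 - t) * D.q (x * p) ^ t) ≤ D.q p := by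
      refine le_trans (mul_le_mul_of_nonneg_left h1 hc.le) ?_
      have : p * ((1 + t * (x - 1)) * D.q ((1 + t * (x - 1)) * p)) ≤ p * D.q p := by linarith
      exact le_of_mul_le_mul_left this hp
    rw [← Real.log_le_log_iff (by positivity) hq, Real.log_mul hc.ne' (by positivity),
      Real.log_mul (by positivity) (by positivity), Real.log_rpow hq, Real.log_rpow h0] at h3
    have h4 := Real.one_sub_inv_le_log_of_pos hc
    have h5 : 1 - (1 + t * (x - 1))⁻¹ = t * ((x - 1) / (1 + t * (x - 1))) := by
      field_simp; ring
    rw [h5] at h4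
    have : t * ((x - 1) / (1 + t * (x - 1))) ≤ t * (Real.log (D.q p) - Real.log (D.q (x * p))) := by
      linarith
    exact le_of_mul_le_mul_left this ht0
  have hlim : Filter.Tendsto (fun t : ℝ => (x - 1) / (1 + t * (x - 1))) (nhdsWithin 0 (Ioi 0))
      (nhds (x - 1)) := by
    have : ContinuousAt (fun t : ℝ => (x - 1) / (1 + t * (x - 1))) 0 := by
      refine ContinuousAt.div (by fun_prop) (by fun_prop) (by simp)
    have h := this.tendsto
    simp only [zero_mul, add_zero, div_one] at h
    exact h.mono_left nhdsWithin_le_nhds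
  refine le_of_tendsto hlim ?_
  filter_upwards [Ioo_mem_nhdsGT (show (0:ℝ) < 1 by norm_num)] with t ht using key t ht

lemma IsOpt.q_ge {p : ℝ} (h : D.IsOpt p) (hM : D.IsMHR) : Real.exp (-1) ≤ D.q p := by
  have := h.q_upper hM (x := 0) le_rfl
  rw [zero_mul, q_zero, sub_zero] at this
  rw [Real.exp_neg, inv_le_iff_one_le_mul₀ (Real.exp_pos 1)]
  exact this

lemma IsOpt.q_lower {p : ℝ} (_h : D.IsOpt p) (hM : D.IsMHR) {x : ℝ} (hx : 0 < x) (hx1 : x < 1) :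
    D.q p ^ x ≤ D.q (x * p) := by
  have := D.q_logconcave hM (u := 0) (v := p) (a := 1 - x) (b := x) (by linarith) hx (by ring)
  simpa [q_zero] using this

lemma IsOpt.unimodal {p : ℝ} (h : D.IsOpt p) (hM : D.IsMHR) {u a b : ℝ} (hu : 0 ≤ u)
    (ha : 0 ≤ a) (hb : 0 ≤ b) (hab : a + b = 1) :
    u * D.q u ≤ (a * u + b * p) * D.q (a * u + b * p) := by
  obtain ⟨hp, hq, hopt⟩ := h
  rcases ha.eq_or_lt with rfl | ha
  · have : b = 1 := by linarith
    subst this; simpa using hopt u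
  rcases hb.eq_or_lt with rfl | hb
  · have : a = 1 := by linarith
    subst this; simp
  have h1 := D.q_logconcave hM (u := u) (v := p) ha hb hab
  have h2 := Real.geom_mean_le_arith_mean2_weighted ha.le hb.le hu hp.le hab
  have hqu := D.q_nonneg u
  have hX : 0 ≤ u * D.q u := by positivity
  calc u * D.q u = (u * D.q u) ^ a * (u * D.q u) ^ b := by
        rw [← Real.rpow_add_of_nonneg hX ha.le hb.le, hab, Real.rpow_one]
    _ ≤ (u * D.q u) ^ a * (p * D.q p) ^ b := by
        exact mul_le_mul_of_nonneg_left (Real.rpow_le_rpow hX (hopt u) hb.le) (Real.rpow_nonneg hX _)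
    _ = (u ^ a * p ^ b) * (D.q u ^ a * D.q p ^ b) := by
        rw [Real.mul_rpow hu hqu, Real.mul_rpow hp.le hq.le]; ring
    _ ≤ _ := by gcongr

lemma IsOpt.mono_left {p : ℝ} (h : D.IsOpt p) (hM : D.IsMHR) {u v : ℝ} (hu : 0 ≤ u)
    (huv : u ≤ v) (hv : v ≤ p) : u * D.q u ≤ v * D.q v := by
  rcases (huv.trans hv).eq_or_lt with he | hlt
  · have : u = v := by linarith
    rw [this]
  have := h.unimodal hM (a := (p - v) / (p - u)) (b := (v - u) / (p - u)) hu
    (div_nonneg (by linarith) (by linarith)) (div_nonneg (by linarith) (by linarith))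
    (by rw [← add_div, div_eq_one_iff_eq (by linarith)]; ring)
  have e : (p - v) / (p - u) * u + (v - u) / (p - u) * p = v := by
    have : p - u ≠ 0 := by linarith
    field_simp; ring
  rwa [e] at this

lemma IsOpt.mono_right {p : ℝ} (h : D.IsOpt p) (hM : D.IsMHR) {u v : ℝ} 
    (hv : p ≤ v) (huv : v ≤ u) : u * D.q u ≤ v * D.q v := by
  rcases (hv.trans huv).eq_or_lt with he | hlt
  · have : u = v := by linarith
    rw [this]
  have := h.unimodal hM (u := u) (a := (v - p) / (u - p)) (b := (u - v) / (u - p)) (by linarith [h.1])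
    (div_nonneg (by linarith) (by linarith)) (div_nonneg (by linarith) (by linarith))
    (by rw [← add_div, div_eq_one_iff_eq (by linarith)]; ring)
  have e : (v - p) / (u - p) * u + (u - v) / (u - p) * p = v := by
    have : u - p ≠ 0 := by linarith
    field_simp; ring
  rwa [e] at this

/-- a comparison price with near optimal revenue and quantile bounded away from `1/e`. -/
lemma IsOpt.exists_ref {p : ℝ} (h : D.IsOpt p) (hM : D.IsMHR) {δ : ℝ} (hδ : 0 < δ) (hδ1 : δ < 1) :
    ∃ w, 1 - δ ≤ w ∧ w ≤ 1 ∧ Real.exp (-1 + δ) ≤ D.q (w * p) ∧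
      (1 - 2 * δ ^ 2) * D.q p ≤ w * D.q (w * p) := by
  have hge := h.q_ge hM
  have hq := h.2.1
  set k := - Real.log (D.q p) with hk
  have hqk : D.q p = Real.exp (-k) := by rw [hk, neg_neg, Real.exp_log hq]
  have hk1 : k ≤ 1 := by
    rw [hqk, Real.exp_le_exp] at hge; linarith
  rcases le_or_gt k (1 - δ) with hc | hc
  · refine ⟨1, by linarith, le_rfl, ?_, ?_⟩
    · rw [one_mul, hqk, Real.exp_le_exp]; linarith
    · rw [one_mul, one_mul]; nlinarith [sq_nonneg δ]
  · have hk0 : 0 < k := by linarith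
    have hx0 : 0 < (1 - δ) / k := div_pos (by linarith) hk0
    have hx1 : (1 - δ) / k < 1 := (div_lt_one hk0).2 hc
    have hxd : 1 - δ ≤ (1 - δ) / k := by
      rw [le_div_iff₀ hk0]; nlinarith
    have hl := h.q_lower hM hx0 hx1
    set x := (1 - δ) / k with hx
    have hkx : k * x = 1 - δ := by rw [hx]; field_simp
    have hl2 : D.q p ^ x = Real.exp (-1 + δ) := by
      rw [hqk, ← Real.exp_mul]; congr 1; linarith
    refine ⟨x, hxd, hx1.le, hl2 ▸ hl, ?_⟩
    have h3 : D.q p * (1 + k * (1 - x)) ≤ D.q (x * p) := by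
      refine le_trans ?_ hl
      rw [hl2]
      have : Real.exp (-1 + δ) = D.q p * Real.exp (k * (1 - x)) := by
        rw [hqk, ← Real.exp_add]; congr 1; linarith
      rw [this]
      have := Real.add_one_le_exp (k * (1 - x))
      gcongr; linarith
    refine le_trans ?_ (mul_le_mul_of_nonneg_left h3 hx0.le)
    have : 1 - 2 * δ ^ 2 ≤ x * (1 + k * (1 - x)) := by
      nlinarith
    nlinarith

end ValueDist

lemma exp_le_quad {y : ℝ} (hy : |y| ≤ 1) : Real.exp y ≤ 1 + y + y ^ 2 := by
  have := Real.abs_exp_sub_one_sub_id_le hy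
  have := (abs_le.1 this).2
  linarith

/-- A Chernoff/Bernstein bound. -/
lemma chernoff (μ : Measure ℝ) [IsProbabilityMeasure μ] (m : ℕ) (Y : ℝ → ℝ) (hY : Measurable Y)
    {B M V l : ℝ} (hB : ∀ x, |Y x| ≤ B) (hM : ∫ x, Y x ∂μ ≤ -M) (hV : ∫ x, Y x ^ 2 ∂μ ≤ V)
    (hl : 0 < l) (hlB : l * B ≤ 1) :
    (Measure.pi fun _ : Fin m => μ).real {s | 0 ≤ ∑ j, Y (s j)} ≤
      Real.exp (m * (-(l * M) + l ^ 2 * V)) := by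
  set P := Measure.pi fun _ : Fin m => μ
  have hlY : ∀ x, |l * Y x| ≤ 1 := by
    intro x; rw [abs_mul, abs_of_pos hl]
    exact (mul_le_mul_of_nonneg_left (hB x) hl.le).trans hlB
  have hiY : Integrable Y μ := Integrable.of_bound hY.aestronglyMeasurable B
    (Filter.Eventually.of_forall hB)
  have hiY2 : Integrable (fun x => Y x ^ 2) μ := by
    refine Integrable.of_bound (hY.pow_const 2).aestronglyMeasurable (B ^ 2)
      (Filter.Eventually.of_forall fun x => ?_)
    rw [norm_pow]; exact pow_le_pow_left₀ (norm_nonneg _) (hB x) 2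
  have hie : Integrable (fun x => Real.exp (l * Y x)) μ := by
    refine Integrable.of_bound (by fun_prop) (Real.exp 1)
      (Filter.Eventually.of_forall fun x => ?_)
    rw [Real.norm_eq_abs, abs_of_pos (Real.exp_pos _), Real.exp_le_exp]
    exact (abs_le.1 (hlY x)).2
  have h1 : ∫ x, Real.exp (l * Y x) ∂μ ≤ Real.exp (-(l * M) + l ^ 2 * V) := by
    calc ∫ x, Real.exp (l * Y x) ∂μ ≤ ∫ x, (1 + l * Y x + l ^ 2 * Y x ^ 2) ∂μ := by
          refine integral_mono hie (((integrable_const 1).add (hiY.const_mul l)).add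
            (hiY2.const_mul (l^2))) fun x => ?_
          have := exp_le_quad (hlY x)
          rw [mul_pow] at this
          exact this
      _ = 1 + l * ∫ x, Y x ∂μ + l ^ 2 * ∫ x, Y x ^ 2 ∂μ := by
          have i1 : Integrable (fun x => 1 + l * Y x) μ := (integrable_const 1).add (hiY.const_mul l)
          rw [integral_add i1 (hiY2.const_mul (l^2)),
            integral_add (integrable_const 1) (hiY.const_mul l), integral_const_mul,
            integral_const_mul]
          simp
      _ ≤ (-(l * M) + l ^ 2 * V) + 1 := by
          have := mul_le_mul_of_nonneg_left hM hl.le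
          have := mul_le_mul_of_nonneg_left hV (sq_nonneg l)
          linarith
      _ ≤ _ := Real.add_one_le_exp _
  have h2 : ∫ s, Real.exp (l * ∑ j, Y (s j)) ∂P = (∫ x, Real.exp (l * Y x) ∂μ) ^ m := by
    have := integral_fintype_prod_eq_pow (𝕜 := ℝ) (ι := Fin m) (μ := μ) (fun x => Real.exp (l * Y x))
    simp only [Fintype.card_fin] at this
    rw [← this]
    congr 1
    funext s
    rw [Finset.mul_sum, Real.exp_sum]
  have h3 : Integrable (fun s : Fin m → ℝ => Real.exp (l * ∑ j, Y (s j))) P := by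
    have := Integrable.fintype_prod (𝕜 := ℝ) (ι := Fin m) (μ := fun _ => μ) (f := fun _ x => Real.exp (l * Y x))
      (fun _ => hie)
    refine this.congr (Filter.Eventually.of_forall fun s => ?_)
    simp only
    rw [Finset.mul_sum, Real.exp_sum]
  have h4 := mul_meas_ge_le_integral_of_nonneg (μ := P) (f := fun s : Fin m → ℝ => Real.exp (l * ∑ j, Y (s j)))
    (Filter.Eventually.of_forall fun s => (Real.exp_pos _).le) h3 1
  have h5 : {s : Fin m → ℝ | 1 ≤ Real.exp (l * ∑ j, Y (s j))} = {s | 0 ≤ ∑ j, Y (s j)} := by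
    ext s
    simp only [mem_ofPred_eq, Real.one_le_exp_iff]
    exact mul_nonneg_iff_of_pos_left hl
  rw [h5, one_mul, h2] at h4
  refine h4.trans ?_
  rw [Real.exp_nat_mul]
  exact pow_le_pow_left₀ (integral_nonneg fun x => (Real.exp_pos _).le) h1 m

noncomputable def ind (t x : ℝ) : ℝ := (Ici t).indicator (fun _ => (1:ℝ)) x

lemma ind_of_le {t x : ℝ} (h : t ≤ x) : ind t x = 1 := by simp [ind, h]
lemma ind_of_lt {t x : ℝ} (h : x < t) : ind t x = 0 := by simp [ind, h]

lemma ind_cases (t x : ℝ) : ind t x = 0 ∨ ind t x = 1 := by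
  rcases le_or_gt t x with h | h
  · exact Or.inr (ind_of_le h)
  · exact Or.inl (ind_of_lt h)

lemma ind_meas (t : ℝ) : Measurable (ind t) :=
  measurable_const.indicator measurableSet_Ici

lemma ind_int (D : ValueDist) (t : ℝ) : ∫ x, ind t x ∂D.μ = D.q t := by
  rw [D.q_eq_Ici]
  unfold ind
  rw [integral_indicator_const _ measurableSet_Ici]; simp

lemma ind_integrable (D : ValueDist) (t : ℝ) : Integrable (ind t) D.μ := by
  have := D.isProb
  exact (integrable_const (1:ℝ)).indicator measurableSet_Ici

lemma empCount_eq {m : ℕ} (s : Fin m → ℝ) (t : ℝ) : (empCount s t : ℝ) = ∑ j, ind t (s j) := by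
  classical
  have : ({j | t ≤ s j} : Set (Fin m)) = ((Finset.univ.filter fun j => t ≤ s j : Finset (Fin m)) : Set (Fin m)) := by
    ext j; simp
  rw [empCount, this, Set.ncard_coe_finset, Finset.card_filter]
  push_cast
  refine Finset.sum_congr rfl fun j _ => ?_
  split_ifs with h
  · rw [ind_of_le h]
  · rw [ind_of_lt (not_le.1 h)]

lemma empCount_anti {m : ℕ} (s : Fin m → ℝ) {t u : ℝ} (h : t ≤ u) : empCount s u ≤ empCount s t :=
  Set.ncard_le_ncard (fun _ hj => le_trans h hj) (Set.toFinite _)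

lemma var_bound {x qa q0 qs T s w : ℝ} (hx0 : 0 ≤ x) (hx4 : x ≤ 4) (hqa0 : 0 ≤ qa) (hqa1 : qa ≤ 1)
    (hqs0 : 0 < qs) (hqs1 : qs ≤ 1) (hs : 0 < s) (hsT : s ≤ T) (hT : T ≤ 1)
    (hR : x * qa = (1 - T ^ 2) * qs) (hexp : qa ≤ qs * Real.exp (1 - x))
    (hw : 1 - s / 3 ≤ w) (hw1 : w ≤ 1) (hq0 : qs ≤ q0) (hwq : w * q0 ≤ qs) :
    2 * (x + s ^ 2 / 12 - w) ^ 2 + 2 * |qa - q0| ≤ 124 * T := by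
  have hT0 : 0 < T := by linarith
  have h1 : 1 - T ^ 2 ≤ x * Real.exp (1 - x) := by
    have : (1 - T ^ 2) * qs ≤ (x * Real.exp (1 - x)) * qs := by
      rw [← hR]; nlinarith [mul_le_mul_of_nonneg_left hexp hx0]
    exact le_of_mul_le_mul_right this hqs0
  have h2 : ((1 + x) / 2) ^ 2 ≤ Real.exp (x - 1) := by
    have := Real.add_one_le_exp ((x - 1) / 2)
    have e : Real.exp (x - 1) = Real.exp ((x - 1) / 2) ^ 2 := by
      rw [← Real.exp_nat_mul]; congr 1; push_cast; ring
    rw [e]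
    refine pow_le_pow_left₀ (by linarith) (by linarith) 2
  have h3 : (1 - T ^ 2) * ((1 + x) / 2) ^ 2 ≤ x := by
    calc (1 - T ^ 2) * ((1 + x) / 2) ^ 2 ≤ (1 - T ^ 2) * Real.exp (x - 1) :=
          mul_le_mul_of_nonneg_left h2 (by nlinarith)
      _ ≤ x * Real.exp (1 - x) * Real.exp (x - 1) :=
          mul_le_mul_of_nonneg_right h1 (Real.exp_pos _).le
      _ = x := by rw [mul_assoc, ← Real.exp_add]; simp
  have h4 : |x - 1| ≤ 5 * T := by
    refine abs_le_of_sq_le_sq ?_ (by linarith)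
    have : ((1 + x) / 2) ^ 2 ≤ 25 / 4 := by nlinarith
    nlinarith [mul_le_mul_of_nonneg_left this (sq_nonneg T)]
  have h4' := abs_le.1 h4
  have hs1 : s ≤ 1 := by linarith
  have hss : s ^ 2 ≤ T := by nlinarith
  have hTT : T ^ 2 ≤ T := by nlinarith
  have h5 : |x + s ^ 2 / 12 - w| ≤ 7 * T := by
    have := sq_nonneg s
    rw [abs_le]; constructor <;> linarith
  have h6 : (x + s ^ 2 / 12 - w) ^ 2 ≤ 49 * T := by
    have := sq_le_sq' (by linarith [(abs_le.1 h5).1]) (abs_le.1 h5).2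
    have e : (7 * T) ^ 2 = 49 * T ^ 2 := by ring
    linarith
  have h7 : q0 - qs ≤ T := by
    have hw2 : 2/3 ≤ w := by linarith
    have a0 : 2/3 * q0 ≤ w * q0 := mul_le_mul_of_nonneg_right hw2 (by linarith)
    have a1 : q0 ≤ 3/2 * qs := by linarith
    have : q0 * (1 - w) ≤ 3/2 * (s/3) := by
      have : q0 * (1 - w) ≤ q0 * (s / 3) := mul_le_mul_of_nonneg_left (by linarith) (by linarith)
      have : q0 * (s / 3) ≤ 3 / 2 * (s / 3) := mul_le_mul_of_nonneg_right (by linarith) (by linarith)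
      linarith
    linarith
  have h8 : |qa - qs| ≤ 12 * T := by
    rcases le_or_gt (1/2) x with hx | hx
    · have e : x * (qa - qs) = qs * (1 - x - T ^ 2) := by linarith
      have e2 : x * |qa - qs| = qs * |1 - x - T ^ 2| := by
        rw [← abs_of_nonneg hx0, ← abs_mul, abs_of_nonneg hx0, e, abs_mul, abs_of_pos hqs0]
      have e3 : |1 - x - T ^ 2| ≤ 6 * T := by
        have := sq_nonneg T
        rw [abs_le]; constructor <;> linarith
      have e4 : qs * |1 - x - T ^ 2| ≤ 6 * T := (mul_le_of_le_one_left (abs_nonneg _) hqs1).trans e3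
      have e5 := mul_le_mul_of_nonneg_right hx (abs_nonneg (qa - qs))
      linarith
    · have : 1 / 10 ≤ T := by linarith
      have : |qa - qs| ≤ 1 := by rw [abs_le]; constructor <;> linarith
      linarith
  have h9 : |qa - q0| ≤ 13 * T := by
    have := abs_le.1 h8
    rw [abs_le]; constructor <;> linarith
  linarith

lemma exp_neg_one_ge : (1:ℝ) / 3 ≤ Real.exp (-1) := by
  rw [Real.exp_neg, one_div]
  exact inv_anti₀ (Real.exp_pos 1) (by linarith [Real.exp_one_lt_d9])

open ValueDist in
lemma cell_bound {D : ValueDist} (hM : D.IsMHR) {p : ℝ} (hp : D.IsOpt p) (m : ℕ) {s x w : ℝ}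
    (hs : 0 < s) (hs1 : s ≤ 1) (hx0 : 0 ≤ x) (hx4 : x ≤ 4)
    (hbad : x * D.q (x * p) ≤ (1 - s ^ 2) * D.q p)
    (hw : 1 - s / 3 ≤ w) (hw1 : w ≤ 1) (hwR : (1 - 2 * (s / 3) ^ 2) * D.q p ≤ w * D.q (w * p)) :
    (Measure.pi fun _ : Fin m => D.μ).real
      {t | 0 ≤ ∑ j, ((x + s ^ 2 / 12) * ind (x * p) (t j) - w * ind (w * p) (t j))} ≤
      Real.exp (-(m * (s ^ 3 / 20000))) := by
  have := D.isProb
  have hq := hp.2.1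
  have hp0 := hp.1
  have hge : 1 / 3 ≤ D.q p := exp_neg_one_ge.trans (hp.q_ge hM)
  have hq1 := D.q_le_one p
  have hqa0 := D.q_nonneg (x * p)
  have hqa1 := D.q_le_one (x * p)
  have hq01 := D.q_le_one (w * p)
  obtain ⟨T, hT0, hT⟩ : ∃ T : ℝ, 0 ≤ T ∧ T ^ 2 = 1 - x * D.q (x * p) / D.q p := by
    refine ⟨_, Real.sqrt_nonneg _, Real.sq_sqrt ?_⟩
    rw [sub_nonneg, div_le_one hq]
    nlinarith [sq_nonneg s]
  have hR : x * D.q (x * p) = (1 - T ^ 2) * D.q p := by rw [hT]; field_simp; ring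
  have hT1 : T ≤ 1 := by
    have : 0 ≤ x * D.q (x * p) / D.q p := by positivity
    nlinarith
  have hsT : s ≤ T := by
    rw [hR] at hbad
    have := le_of_mul_le_mul_right hbad hq
    exact abs_le_of_sq_le_sq' (by linarith) hT0 |>.2
  have hwq : w * D.q (w * p) ≤ D.q p := by
    have := hp.2.2 (w * p)
    have : p * (w * D.q (w * p)) ≤ p * D.q p := by linarith
    exact le_of_mul_le_mul_left this hp0
  have hq0 : D.q p ≤ D.q (w * p) := D.q_anti (by nlinarith)
  have hvar := var_bound hx0 hx4 hqa0 hqa1 hq hq1 hs hsT hT1 hR (hp.q_upper hM hx0) hw hw1 hq0 hwq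
  set y := x + s ^ 2 / 12 with hy
  have hy0 : 0 ≤ y := by positivity
  have hy5 : y ≤ 5 := by nlinarith
  have hw0 : 0 ≤ w := by linarith
  have i1 := (ind_integrable D (x * p))
  have i2 := (ind_integrable D (w * p))
  have hint : ∫ z, (y * ind (x * p) z - w * ind (w * p) z) ∂D.μ = y * D.q (x * p) - w * D.q (w * p) := by
    rw [integral_sub (i1.const_mul y) (i2.const_mul w), integral_const_mul, integral_const_mul,
      ind_int, ind_int]
  have habs : ∀ z, (y * ind (x * p) z - w * ind (w * p) z) ^ 2 ≤ 
      2 * (y - w) ^ 2 + 2 * |ind (x * p) z - ind (w * p) z| := by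
    intro z
    rcases ind_cases (x * p) z with h1 | h1 <;> rcases ind_cases (w * p) z with h2 | h2 <;>
      rw [h1, h2]
    · norm_num; positivity
    · norm_num; nlinarith [sq_nonneg (y - w)]
    · norm_num; nlinarith [sq_nonneg (y - 2 * w)]
    · norm_num; nlinarith [sq_nonneg (y - w)]
  have hintabs : ∫ z, |ind (x * p) z - ind (w * p) z| ∂D.μ = |D.q (x * p) - D.q (w * p)| := by
    have gen : ∀ a b : ℝ, a ≤ b → ∫ z, |ind a z - ind b z| ∂D.μ = |D.q a - D.q b| := by
      intro a b hab
      have hpt : ∀ z, |ind a z - ind b z| = ind a z - ind b z := by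
        intro z
        apply abs_of_nonneg
        rcases le_or_gt b z with h | h
        · rw [ind_of_le h, ind_of_le (hab.trans h)]; simp
        · rw [ind_of_lt h]; rcases ind_cases a z with h | h <;> rw [h] <;> norm_num
      simp_rw [hpt]
      rw [integral_sub (ind_integrable D a) (ind_integrable D b), ind_int, ind_int, abs_of_nonneg]
      linarith [D.q_anti hab]
    rcases le_total (x * p) (w * p) with h | h
    · exact gen _ _ h
    · simp_rw [abs_sub_comm (ind (x * p) _)]
      rw [abs_sub_comm]; exact gen _ _ h
  have hV : ∫ z, (y * ind (x * p) z - w * ind (w * p) z) ^ 2 ∂D.μ ≤ 124 * T := by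
    refine le_trans ?_ hvar
    have i3 : Integrable (fun z => |ind (x * p) z - ind (w * p) z|) D.μ := (i1.sub i2).abs
    have i4 : Integrable (fun z => 2 * (y - w) ^ 2 + 2 * |ind (x * p) z - ind (w * p) z|) D.μ :=
      (integrable_const _).add (i3.const_mul 2)
    calc _ ≤ ∫ z, (2 * (y - w) ^ 2 + 2 * |ind (x * p) z - ind (w * p) z|) ∂D.μ := by
          refine integral_mono_of_nonneg (Filter.Eventually.of_forall fun z => sq_nonneg _) i4
            (Filter.Eventually.of_forall habs)
      _ = _ := by
          have i5 : Integrable (fun _ : ℝ => 2 * (y - w) ^ 2) D.μ := integrable_const _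
          have e1 : ∫ z, 2 * |ind (x * p) z - ind (w * p) z| ∂D.μ = 2 * |D.q (x * p) - D.q (w * p)| := by
            rw [integral_const_mul, hintabs]
          rw [integral_add i5 (i3.const_mul 2), e1]
          simp only [integral_const, probReal_univ, one_smul]
  have hmean : ∫ z, (y * ind (x * p) z - w * ind (w * p) z) ∂D.μ ≤ -(T ^ 2 / 6) := by
    rw [hint]
    have e1 : y * D.q (x * p) ≤ (1 - T ^ 2) * D.q p + s ^ 2 / 12 := by
      rw [← hR, hy]
      have := mul_le_mul_of_nonneg_left hqa1 (show 0 ≤ s ^ 2 / 12 by positivity)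
      linarith
    have e2 : s ^ 2 ≤ T ^ 2 := pow_le_pow_left₀ hs.le hsT 2
    have e3 := mul_le_mul_of_nonneg_left hge (sq_nonneg T)
    have e4 := mul_le_mul_of_nonneg_right e2 hq.le
    linarith
  have hch := chernoff D.μ m (fun z => y * ind (x * p) z - w * ind (w * p) z)
    (((ind_meas _).const_mul _).sub ((ind_meas _).const_mul _)) (B := 5) (l := T / 1500) (by
      intro z
      rw [abs_le]
      rcases ind_cases (x * p) z with h1 | h1 <;> rcases ind_cases (w * p) z with h2 | h2 <;>
        simp only [h1, h2] <;> constructor <;> linarith) hmean hV (by linarith) (by linarith)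
  refine hch.trans ?_
  rw [Real.exp_le_exp]
  have hs3 : s ^ 3 ≤ T ^ 3 := pow_le_pow_left₀ hs.le hsT 3
  have hT3 : 0 ≤ T ^ 3 := by positivity
  have : -(T / 1500 * (T ^ 2 / 6)) + (T / 1500) ^ 2 * (124 * T) ≤ - (s ^ 3 / 20000) := by
    have e : -(T / 1500 * (T ^ 2 / 6)) + (T / 1500) ^ 2 * (124 * T) = T ^ 3 * (-(1/9000) + 124 / 2250000) := by
      ring
    rw [e]; linarith
  have := mul_le_mul_of_nonneg_left this (Nat.cast_nonneg (α := ℝ) m)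
  linarith

open ValueDist in
/-- the reference price passes the guard -/
lemma guard_low {D : ValueDist} {a s : ℝ} (m : ℕ) (hs : 0 < s) (hs1 : s ≤ 1)
    (ha : Real.exp (-1 + s / 3) ≤ D.q a) :
    (Measure.pi fun _ : Fin m => D.μ).real {t | 0 ≤ ∑ j, (Real.exp (-1) - ind a (t j))} ≤
      Real.exp (-(m * (s ^ 3 / 20000))) := by
  have := D.isProb
  have he := exp_neg_one_ge
  have he1 : Real.exp (-1) ≤ 1 := by rw [Real.exp_le_one_iff]; norm_num
  have hb : ∀ z, |Real.exp (-1) - ind a z| ≤ 1 := by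
    intro z
    rw [abs_le]
    rcases ind_cases a z with h1 | h1 <;> rw [h1] <;> constructor <;> linarith
  have hmean : ∫ z, (Real.exp (-1) - ind a z) ∂D.μ ≤ -(s / 9) := by
    rw [integral_sub (integrable_const _) (ind_integrable D a), ind_int]
    simp only [integral_const, probReal_univ, one_smul]
    rw [Real.exp_add] at ha
    have := Real.add_one_le_exp (s / 3)
    nlinarith
  have hV : ∫ z, (Real.exp (-1) - ind a z) ^ 2 ∂D.μ ≤ 1 := by
    have : ∫ z, (Real.exp (-1) - ind a z) ^ 2 ∂D.μ ≤ ∫ z, (1:ℝ) ∂D.μ := by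
      refine integral_mono_of_nonneg (Filter.Eventually.of_forall fun z => sq_nonneg _)
        (integrable_const _) (Filter.Eventually.of_forall fun z => ?_)
      have := abs_le.1 (hb z)
      simp only
      nlinarith
    simpa using this
  have hch := chernoff D.μ m _ (measurable_const.sub (ind_meas a)) hb hmean hV (l := s / 18)
    (by linarith) (by linarith)
  refine hch.trans ?_
  rw [Real.exp_le_exp]
  have : -(s / 18 * (s / 9)) + (s / 18) ^ 2 * 1 ≤ - (s ^ 3 / 20000) := by nlinarith [sq_nonneg s]
  have := mul_le_mul_of_nonneg_left this (Nat.cast_nonneg (α := ℝ) m)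
  linarith

open ValueDist in
/-- too large prices fail the guard -/
lemma guard_high {D : ValueDist} (hM : D.IsMHR) {p s : ℝ} (hp : D.IsOpt p) (m : ℕ) (hs : 0 < s) (hs1 : s ≤ 1) :
    (Measure.pi fun _ : Fin m => D.μ).real {t | 0 ≤ ∑ j, (ind (4 * p) (t j) - Real.exp (-1))} ≤
      Real.exp (-(m * (s ^ 3 / 20000))) := by
  have := D.isProb
  have he := exp_neg_one_ge
  have he1 : Real.exp (-1) ≤ 1 := by rw [Real.exp_le_one_iff]; norm_num
  have hb : ∀ z, |ind (4 * p) z - Real.exp (-1)| ≤ 1 := by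
    intro z
    rw [abs_le]
    rcases ind_cases (4 * p) z with h1 | h1 <;> rw [h1] <;> constructor <;> linarith
  have h4 : D.q (4 * p) ≤ 1 / 8 := by
    have h := hp.q_upper hM (x := 4) (by norm_num)
    have h1 := D.q_le_one p
    have h2 : Real.exp (1 - 4) ≤ 1 / 8 := by
      have e : Real.exp (1 - 4) = (Real.exp 1 ^ 3)⁻¹ := by
        rw [← Real.exp_nat_mul, ← Real.exp_neg]; norm_num
      rw [e, one_div]
      apply inv_anti₀ (by norm_num)
      have : (2:ℝ) ≤ Real.exp 1 := by linarith [Real.exp_one_gt_d9]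
      calc (8:ℝ) = 2 ^ 3 := by norm_num
        _ ≤ _ := by gcongr
    exact h.trans ((mul_le_of_le_one_left (Real.exp_pos _).le h1).trans h2)
  have hmean : ∫ z, (ind (4 * p) z - Real.exp (-1)) ∂D.μ ≤ -(1 / 6) := by
    rw [integral_sub (ind_integrable D _) (integrable_const _), ind_int]
    simp only [integral_const, probReal_univ, one_smul]
    linarith
  have hV : ∫ z, (ind (4 * p) z - Real.exp (-1)) ^ 2 ∂D.μ ≤ 1 := by
    have : ∫ z, (ind (4 * p) z - Real.exp (-1)) ^ 2 ∂D.μ ≤ ∫ z, (1:ℝ) ∂D.μ := by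
      refine integral_mono_of_nonneg (Filter.Eventually.of_forall fun z => sq_nonneg _)
        (integrable_const _) (Filter.Eventually.of_forall fun z => ?_)
      have := abs_le.1 (hb z)
      simp only
      nlinarith
    simpa using this
  have hch := chernoff D.μ m _ ((ind_meas (4 * p)).sub measurable_const) hb hmean hV (l := 1 / 12)
    (by linarith) (by linarith)
  refine hch.trans ?_
  rw [Real.exp_le_exp]
  have hs3 : s ^ 3 ≤ 1 := pow_le_one₀ hs.le hs1
  have : -((1:ℝ) / 12 * (1 / 6)) + (1 / 12) ^ 2 * 1 ≤ - (s ^ 3 / 20000) := by linarith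
  have := mul_le_mul_of_nonneg_left this (Nat.cast_nonneg (α := ℝ) m)
  linarith

lemma int_lower {D : ValueDist} {p : ℝ} (hp : D.IsOpt p) {m : ℕ} {ER : (Fin m → ℝ) → ℝ}
    (hER : Measurable ER)
    (hg : ∀ s, IsGuardedEmpiricalReserve (Real.exp 1)⁻¹ s (ER s)) {E : Set (Fin m → ℝ)}
    (hE : MeasurableSet E) {c : ℝ} (hc : ∀ t ∈ E, c ≤ ER t * D.q (ER t)) :
    c * (Measure.pi fun _ : Fin m => D.μ).real E ≤
      ∫ s : Fin m → ℝ, ER s * (1 - D.F (ER s)) ∂(Measure.pi fun _ : Fin m => D.μ) := by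
  have := D.isProb
  set P := Measure.pi fun _ : Fin m => D.μ with hP
  change _ ≤ ∫ s : Fin m → ℝ, ER s * D.q (ER s) ∂P
  have hae : ∀ᵐ t ∂P, 0 ≤ ER t := by
    have h1 : ∀ᵐ t ∂P, ∀ i, 0 ≤ t i := by
      rw [ae_all_iff]
      intro i
      have h0 : ∀ᵐ x ∂D.μ, 0 ≤ x := by
        have : D.μ (Iio 0) = 0 := D.meas_null measurableSet_Iio
          (fun x hx h => absurd (D.supp_subset h) (by simpa using hx))
        rw [ae_iff]
        convert this using 2
        ext x; simp
      exact (Measure.tendsto_eval_ae_ae (μ := fun _ : Fin m => D.μ) (i := i)).eventually h0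
    filter_upwards [h1] with t ht
    obtain ⟨⟨i, hi⟩, -⟩ := hg t
    rw [hi]; exact ht i
  have hint : Integrable (fun t => ER t * D.q (ER t)) P := by
    refine Integrable.of_bound (hER.mul (D.q_cont.measurable.comp hER)).aestronglyMeasurable
      (p * D.q p) ?_
    filter_upwards [hae] with t ht
    rw [Real.norm_eq_abs, abs_of_nonneg (mul_nonneg ht (D.q_nonneg _))]
    exact hp.2.2 _
  have h1 : ∫ t, E.indicator (fun _ => c) t ∂P = c * P.real E := by
    rw [integral_indicator_const _ hE, smul_eq_mul, mul_comm]
  rw [← h1]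
  refine integral_mono_ae ((integrable_const c).indicator hE) hint ?_
  filter_upwards [hae] with t ht
  by_cases htE : t ∈ E
  · rw [indicator_of_mem htE]; exact hc t htE
  · rw [indicator_of_notMem htE]; exact mul_nonneg ht (D.q_nonneg _)

lemma grid {D : ValueDist} (hM : D.IsMHR) {p : ℝ} (hp : D.IsOpt p) {s : ℝ} (hs : 0 < s) :
    ∃ G : Finset ℝ, (G.card : ℝ) ≤ 48 / s ^ 2 + 2 ∧
      (∀ x ∈ G, 0 ≤ x ∧ x ≤ 4 ∧ x * D.q (x * p) ≤ (1 - s ^ 2) * D.q p) ∧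
      ∀ x, 0 ≤ x → x ≤ 4 → x * D.q (x * p) ≤ (1 - s ^ 2) * D.q p →
        ∃ a ∈ G, a ≤ x ∧ x ≤ a + s ^ 2 / 12 := by
  classical
  have hp0 := hp.1
  set η := s ^ 2 / 12 with hη
  have hη0 : 0 < η := by positivity
  set x1 := sInf {x : ℝ | 1 ≤ x ∧ x * D.q (x * p) ≤ (1 - s ^ 2) * D.q p} with hx1
  set K := ⌊4 / η⌋₊ with hK
  set G0 : Finset ℝ := insert x1 ((Finset.range (K + 1)).image fun k : ℕ => (k : ℝ) * η)
  have hcl : IsClosed {x : ℝ | 1 ≤ x ∧ x * D.q (x * p) ≤ (1 - s ^ 2) * D.q p} := by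
    have := D.q_cont
    apply IsClosed.and
    · exact isClosed_le continuous_const continuous_id
    · exact isClosed_le (by fun_prop) continuous_const
  have hbdd : BddBelow {x : ℝ | 1 ≤ x ∧ x * D.q (x * p) ≤ (1 - s ^ 2) * D.q p} :=
    ⟨1, fun x hx => hx.1⟩
  refine ⟨G0.filter fun x => 0 ≤ x ∧ x ≤ 4 ∧ x * D.q (x * p) ≤ (1 - s ^ 2) * D.q p, ?_, ?_, ?_⟩
  · have h1 : (G0.filter fun x => 0 ≤ x ∧ x ≤ 4 ∧ x * D.q (x * p) ≤ (1 - s ^ 2) * D.q p).card ≤ K + 2 := by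
      refine (Finset.card_filter_le _ _).trans ((Finset.card_insert_le _ _).trans ?_)
      have := Finset.card_image_le (s := Finset.range (K + 1)) (f := fun k : ℕ => (k : ℝ) * η)
      rw [Finset.card_range] at this
      omega
    have h2 : (K : ℝ) ≤ 4 / η := Nat.floor_le (by positivity)
    have h3 : 4 / η = 48 / s ^ 2 := by rw [hη]; field_simp; norm_num
    rw [← h3]
    have : ((G0.filter fun x => 0 ≤ x ∧ x ≤ 4 ∧ x * D.q (x * p) ≤ (1 - s ^ 2) * D.q p).card : ℝ) ≤ K + 2 := by
      exact_mod_cast h1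
    linarith
  · intro x hx
    exact (Finset.mem_filter.1 hx).2
  · intro x hx0 hx4 hbad
    set k := ⌊x / η⌋₊ with hk
    have hk1 : (k : ℝ) * η ≤ x := by
      rw [← le_div_iff₀ hη0]; exact Nat.floor_le (by positivity)
    have hk2 : x ≤ (k : ℝ) * η + η := by
      have := (Nat.lt_floor_add_one (x / η)).le
      rw [div_le_iff₀ hη0] at this
      linarith
    have hkK : k ∈ Finset.range (K + 1) := by
      rw [Finset.mem_range, Nat.lt_succ_iff]
      apply Nat.floor_le_floor
      gcongr
    have hkG : (k : ℝ) * η ∈ G0 := Finset.mem_insert_of_mem (Finset.mem_image_of_mem _ hkK)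
    have hk0 : 0 ≤ (k : ℝ) * η := by positivity
    rcases le_or_gt x 1 with hx1' | hx1'
    · refine ⟨(k : ℝ) * η, Finset.mem_filter.2 ⟨hkG, hk0, hk1.trans hx4, ?_⟩, hk1, hk2⟩
      refine le_trans ?_ hbad
      have := hp.mono_left hM (u := (k : ℝ) * η * p) (v := x * p) (by positivity)
        (by gcongr) (by nlinarith)
      refine le_of_mul_le_mul_left (a := p) ?_ hp0
      linarith
    · have hmem : x1 ∈ {x : ℝ | 1 ≤ x ∧ x * D.q (x * p) ≤ (1 - s ^ 2) * D.q p} :=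
        hcl.csInf_mem ⟨x, hx1'.le, hbad⟩ hbdd
      have hle : x1 ≤ x := csInf_le hbdd ⟨hx1'.le, hbad⟩
      obtain ⟨hm1, hm2⟩ := hmem
      rcases le_or_gt x1 ((k : ℝ) * η) with h | h
      · refine ⟨(k : ℝ) * η, Finset.mem_filter.2 ⟨hkG, hk0, hk1.trans hx4, ?_⟩, hk1, hk2⟩
        refine le_trans ?_ hm2
        have := hp.mono_right hM (u := (k : ℝ) * η * p) (v := x1 * p) (by nlinarith) (by gcongr)
        refine le_of_mul_le_mul_left (a := p) ?_ hp0
        linarith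
      · exact ⟨x1, Finset.mem_filter.2 ⟨Finset.mem_insert_self _ _, by linarith, hle.trans hx4, hm2⟩,
          hle, by linarith⟩

lemma main_bound {D : ValueDist} (hM : D.IsMHR) {p : ℝ} (hp : D.IsOpt p) {m : ℕ} (hm : 0 < m)
    {ER : (Fin m → ℝ) → ℝ} (hER : Measurable ER)
    (hg : ∀ s, IsGuardedEmpiricalReserve (Real.exp 1)⁻¹ s (ER s)) {s : ℝ} (hs : 0 < s) (hs1 : s ≤ 1) :
    ((1 - s ^ 2) * (p * D.q p)) * (1 - (48 / s ^ 2 + 4) * Real.exp (-(m * (s ^ 3 / 20000)))) ≤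
      ∫ s : Fin m → ℝ, ER s * (1 - D.F (ER s)) ∂(Measure.pi fun _ : Fin m => D.μ) := by
  have := D.isProb
  have hp0 := hp.1
  have hm0 : (0:ℝ) < m := by exact_mod_cast hm
  obtain ⟨w, hw, hw1, hwq, hwR⟩ := hp.exists_ref hM (δ := s / 3) (by linarith) (by linarith)
  obtain ⟨G, hcard, hGbad, hGcov⟩ := grid hM hp hs
  have hw0 : 0 < w := by linarith
  set P := Measure.pi fun _ : Fin m => D.μ with hP
  set EX : ℝ → Set (Fin m → ℝ) := fun x =>
    {t | 0 ≤ ∑ j, ((x + s ^ 2 / 12) * ind (x * p) (t j) - w * ind (w * p) (t j))} with hEX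
  set EL : Set (Fin m → ℝ) := {t | 0 ≤ ∑ j, (Real.exp (-1) - ind (w * p) (t j))} with hEL
  set EH : Set (Fin m → ℝ) := {t | 0 ≤ ∑ j, (ind (4 * p) (t j) - Real.exp (-1))} with hEH
  set β := Real.exp (-(m * (s ^ 3 / 20000))) with hβ
  have hβ0 : 0 < β := Real.exp_pos _
  have hindm : ∀ a : ℝ, ∀ j : Fin m, Measurable fun t : Fin m → ℝ => ind a (t j) :=
    fun a j => (ind_meas a).comp (measurable_pi_apply j)
  have mX : ∀ x, MeasurableSet (EX x) := fun x =>
    measurableSet_le measurable_const (Finset.measurable_sum _ fun j _ =>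
      ((hindm _ j).const_mul _).sub ((hindm _ j).const_mul _))
  have mL : MeasurableSet EL :=
    measurableSet_le measurable_const (Finset.measurable_sum _ fun j _ =>
      measurable_const.sub (hindm _ j))
  have mH : MeasurableSet EH :=
    measurableSet_le measurable_const (Finset.measurable_sum _ fun j _ =>
      (hindm _ j).sub measurable_const)
  set E : Set (Fin m → ℝ) := (⋃ x ∈ G, EX x) ∪ (EL ∪ EH) with hE
  have mE : MeasurableSet E := (Finset.measurableSet_biUnion G fun x _ => mX x).union (mL.union mH)
  have hPE : P.real E ≤ (48 / s ^ 2 + 4) * β := by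
    have h1 : P.real (⋃ x ∈ G, EX x) ≤ G.card * β := by
      refine (measureReal_biUnion_finset_le G EX).trans ?_
      have : ∑ x ∈ G, P.real (EX x) ≤ ∑ x ∈ G, β := Finset.sum_le_sum fun x hx => by
        obtain ⟨h1, h2, h3⟩ := hGbad x hx
        exact cell_bound hM hp m hs hs1 h1 h2 h3 hw hw1 hwR
      simpa using this
    have h2 : P.real EL ≤ β := guard_low m hs hs1 hwq
    have h3 : P.real EH ≤ β := guard_high hM hp m hs hs1
    have h4 := measureReal_union_le (μ := P) (⋃ x ∈ G, EX x) (EL ∪ EH)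
    have h5 := measureReal_union_le (μ := P) EL EH
    have h6 := mul_le_mul_of_nonneg_right hcard hβ0.le
    rw [← hE] at h4
    linarith
  have hgood : ∀ t ∈ Eᶜ, (1 - s ^ 2) * (p * D.q p) ≤ ER t * D.q (ER t) := by
    intro t ht
    simp only [hE, mem_compl_iff, mem_union, mem_iUnion, not_or, not_exists] at ht
    obtain ⟨hX, hL, hH⟩ := ht
    have hL' : Real.exp (-1) * m < empCount t (w * p) := by
      rw [empCount_eq]
      have : ¬ (0 ≤ ∑ j, (Real.exp (-1) - ind (w * p) (t j))) := hL
      rw [Finset.sum_sub_distrib] at this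
      simp at this
      linarith
    have hH' : empCount t (4 * p) < Real.exp (-1) * m := by
      rw [empCount_eq]
      have : ¬ (0 ≤ ∑ j, (ind (4 * p) (t j) - Real.exp (-1))) := hH
      rw [Finset.sum_sub_distrib] at this
      simp at this
      linarith
    have hX' : ∀ x ∈ G, (x + s ^ 2 / 12) * empCount t (x * p) < w * empCount t (w * p) := by
      intro x hx
      rw [empCount_eq, empCount_eq]
      have : ¬ (0 ≤ ∑ j, ((x + s ^ 2 / 12) * ind (x * p) (t j) - w * ind (w * p) (t j))) := hX x hx
      rw [Finset.sum_sub_distrib, ← Finset.mul_sum, ← Finset.mul_sum] at this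
      linarith
    obtain ⟨-, hgd, hmax⟩ := hg t
    rw [← Real.exp_neg] at hgd hmax
    -- the smallest sample above the reference price
    have hne : (Finset.univ.filter fun j : Fin m => w * p ≤ t j).Nonempty := by
      by_contra hcon
      rw [Finset.not_nonempty_iff_eq_empty, Finset.filter_eq_empty_iff] at hcon
      have : (empCount t (w * p) : ℝ) = 0 := by
        rw [empCount_eq]
        exact Finset.sum_eq_zero fun j hj => ind_of_lt (not_le.1 (hcon hj))
      have := Real.exp_pos (-1)
      nlinarith
    obtain ⟨i, hi, himin⟩ := Finset.exists_min_image _ t hne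
    rw [Finset.mem_filter] at hi
    have hcount : empCount t (t i) = empCount t (w * p) := by
      refine le_antisymm (empCount_anti t hi.2) ?_
      refine Set.ncard_le_ncard (fun j hj => ?_) (Set.toFinite _)
      exact himin j (Finset.mem_filter.2 ⟨Finset.mem_univ _, hj⟩)
    have h1 := hmax i (by rw [hcount]; exact hL'.le)
    rw [hcount] at h1
    set N0 : ℝ := (empCount t (w * p) : ℝ)
    set r := ER t
    set Nr : ℝ := (empCount t r : ℝ)
    have hN0 : 0 < N0 := lt_trans (by positivity) hL'
    have h2 : w * p * N0 ≤ r * Nr := le_trans (mul_le_mul_of_nonneg_right hi.2 hN0.le) h1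
    have hNr : 0 < Nr := lt_of_lt_of_le (by positivity) hgd
    have hr0 : 0 < r := by
      have : 0 < r * Nr := lt_of_lt_of_le (by positivity) h2
      exact pos_of_mul_pos_left this hNr.le
    have hr4 : r ≤ 4 * p := by
      by_contra hcon
      push Not at hcon
      have : Nr ≤ empCount t (4 * p) := Nat.cast_le.2 (empCount_anti t hcon.le)
      linarith
    by_contra hcon
    push Not at hcon
    set x := r / p with hx
    have hrx : r = x * p := by rw [hx]; field_simp
    have hx0 : 0 ≤ x := by positivity
    have hx4 : x ≤ 4 := by rw [hx, div_le_iff₀ hp0]; exact hr4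
    have hbad : x * D.q (x * p) ≤ (1 - s ^ 2) * D.q p := by
      refine le_of_mul_le_mul_left (a := p) ?_ hp0
      rw [hrx] at hcon
      linarith
    obtain ⟨a, haG, hax, hxa⟩ := hGcov x hx0 hx4 hbad
    have h3 := hX' a haG
    have h4 : Nr ≤ empCount t (a * p) := by
      have : a * p ≤ r := by rw [hrx]; gcongr
      exact Nat.cast_le.2 (empCount_anti t this)
    have h5 : x * Nr ≤ (a + s ^ 2 / 12) * empCount t (a * p) := by
      gcongr
      linarith
    have h6 : p * (w * N0) ≤ p * (x * Nr) := by
      have : r * Nr = p * (x * Nr) := by rw [hrx]; ring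
      linarith
    have := le_of_mul_le_mul_left h6 hp0
    linarith
  refine le_trans ?_ (int_lower hp hER hg mE.compl hgood)
  have hc : 0 ≤ (1 - s ^ 2) * (p * D.q p) := by
    have := hp.2.1
    have : s ^ 2 ≤ 1 := pow_le_one₀ hs.le hs1
    have : 0 ≤ 1 - s ^ 2 := by linarith
    positivity
  refine mul_le_mul_of_nonneg_left ?_ hc
  rw [probReal_compl_eq_one_sub mE]
  linarith

lemma small_bound {D : ValueDist} (hM : D.IsMHR) {p : ℝ} (hp : D.IsOpt p) {m : ℕ}
    {ER : (Fin m → ℝ) → ℝ} (hER : Measurable ER)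
    (hg : ∀ s, IsGuardedEmpiricalReserve (Real.exp 1)⁻¹ s (ER s)) :
    (p * D.q p) / 6 * (1 / 6) ^ m ≤
      ∫ s : Fin m → ℝ, ER s * (1 - D.F (ER s)) ∂(Measure.pi fun _ : Fin m => D.μ) := by
  have := D.isProb
  have hp0 := hp.1
  have hge := exp_neg_one_ge.trans (hp.q_ge hM)
  obtain ⟨v, hv⟩ := D.exists_q_mem (t := 1 / 6) (by norm_num) (by norm_num)
  have hpv : p ≤ v := by
    by_contra h
    push Not at h
    have := D.q_anti h.le
    linarith
  set E : Set (Fin m → ℝ) := Set.pi univ fun _ => Icc p v with hE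
  have mE : MeasurableSet E := MeasurableSet.univ_pi fun _ => measurableSet_Icc
  have hA : 1 / 6 ≤ D.μ.real (Icc p v) := by
    have h1 : Ici p ⊆ Icc p v ∪ Ici v := by
      intro z hz
      rcases le_total z v with h | h
      · exact Or.inl ⟨hz, h⟩
      · exact Or.inr h
    have h2 := measureReal_mono (μ := D.μ) h1
    have h3 := measureReal_union_le (μ := D.μ) (Icc p v) (Ici v)
    rw [← D.q_eq_Ici] at h2 h3
    linarith
  have hPE : (1 / 6 : ℝ) ^ m ≤ (Measure.pi fun _ : Fin m => D.μ).real E := by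
    rw [measureReal_def, hE, Measure.pi_pi]
    simp only [Finset.prod_const, Finset.card_univ, Fintype.card_fin, ENNReal.toReal_pow]
    exact pow_le_pow_left₀ (by norm_num) hA m
  have hR0 : 0 ≤ p * D.q p := mul_nonneg hp0.le (D.q_nonneg _)
  refine le_trans (mul_le_mul_of_nonneg_left hPE (by positivity)) (int_lower hp hER hg mE ?_)
  intro t ht
  obtain ⟨⟨i, hi⟩, -⟩ := hg t
  have hti : t i ∈ Icc p v := ht i (mem_univ i)
  rw [hi]
  have h1 : 1 / 6 ≤ D.q (t i) := by rw [← hv]; exact D.q_anti hti.2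
  have h2 := D.q_le_one p
  have h3 := D.q_nonneg p
  calc p * D.q p / 6 ≤ p * (1 / 6) := by nlinarith
    _ ≤ t i * D.q (t i) := by
      have := hti.1
      have : 0 ≤ t i := by linarith
      gcongr

lemma main_eps {D : ValueDist} (hM : D.IsMHR) {p : ℝ} (hp : D.IsOpt p) {m : ℕ}
    {ER : (Fin m → ℝ) → ℝ} (hER : Measurable ER)
    (hg : ∀ s, IsGuardedEmpiricalReserve (Real.exp 1)⁻¹ s (ER s)) {ε : ℝ} (hε : 0 < ε)
    (hε1 : ε ≤ 1 / 2) (hmε : 600000 * ε ^ (-(3:ℝ)/2) * Real.log (1/ε) ≤ (m : ℝ)) :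
    (1 - ε) * (p * D.q p) ≤
      ∫ s : Fin m → ℝ, ER s * (1 - D.F (ER s)) ∂(Measure.pi fun _ : Fin m => D.μ) := by
  have hR0 : 0 ≤ p * D.q p := mul_nonneg hp.1.le (D.q_nonneg _)
  have hlog : 0 < Real.log (1 / ε) := Real.log_pos (by rw [lt_div_iff₀ hε]; linarith)
  have hm0 : (0:ℝ) < m := lt_of_lt_of_le (by positivity) hmε
  have hm : 0 < m := by exact_mod_cast hm0
  set z := Real.sqrt ε with hz
  have hz0 : 0 < z := Real.sqrt_pos.2 hε
  have hzz : z ^ 2 = ε := Real.sq_sqrt hε.le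
  have hz3 : ε ^ (-(3:ℝ)/2) = (z ^ 3)⁻¹ := by
    rw [← hzz, ← Real.rpow_natCast z 2, ← Real.rpow_mul hz0.le, ← Real.rpow_natCast z 3,
      ← Real.rpow_neg hz0.le]
    norm_num
  rw [hz3] at hmε
  have hmz : 600000 * Real.log (1 / ε) ≤ m * z ^ 3 := by
    have := mul_le_mul_of_nonneg_right hmε (show 0 ≤ z ^ 3 by positivity)
    have e : 600000 * (z ^ 3)⁻¹ * Real.log (1 / ε) * z ^ 3 = 600000 * Real.log (1 / ε) := by
      field_simp
    linarith
  -- use s = z/√2, bounded using s = (7/10) z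
  set s := 7 / 10 * z with hs
  have hz1 : z ≤ 1 := by nlinarith
  have hs0 : 0 < s := by positivity
  have hs2 : s ^ 2 = 49 / 100 * ε := by rw [hs, mul_pow, hzz]; norm_num
  have hs3 : s ^ 3 = 343 / 1000 * z ^ 3 := by rw [hs, mul_pow]; norm_num
  have hmain := main_bound hM hp hm hER hg hs0 (by linarith)
  refine le_trans ?_ hmain
  have hexp : Real.exp (-(m * (s ^ 3 / 20000))) ≤ ε ^ 10 := by
    have : ε ^ 10 = Real.exp (-(10 * Real.log (1 / ε))) := by
      rw [one_div, Real.log_inv, mul_neg, neg_neg, ← Real.log_rpow hε, Real.exp_log (by positivity)]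
      exact_mod_cast (Real.rpow_natCast ε 10).symm
    rw [this, Real.exp_le_exp, hs3]
    linarith
  have hβ : (48 / s ^ 2 + 4) * Real.exp (-(m * (s ^ 3 / 20000))) ≤ 1 / 2 * ε := by
    rw [hs2]
    calc (48 / (49 / 100 * ε) + 4) * Real.exp (-(m * (s ^ 3 / 20000)))
        ≤ (48 / (49 / 100 * ε) + 4) * ε ^ 10 := by gcongr
      _ = (4800 / 49 + 4 * ε) * ε ^ 8 * ε := by field_simp; ring
      _ ≤ 1 / 2 * ε := by
        have h8 : ε ^ 8 ≤ (1 / 2) ^ 8 := pow_le_pow_left₀ hε.le hε1 8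
        have : (4800 / 49 + 4 * ε) * ε ^ 8 ≤ 100 * (1 / 2) ^ 8 := by
          apply mul_le_mul (by linarith) h8 (by positivity) (by norm_num)
        refine mul_le_mul_of_nonneg_right ?_ hε.le
        norm_num at this ⊢
        linarith
  set X := (48 / s ^ 2 + 4) * Real.exp (-(m * (s ^ 3 / 20000)))
  have hX0 : 0 ≤ X := by positivity
  have : 1 - ε ≤ (1 - s ^ 2) * (1 - X) := by rw [hs2]; nlinarith
  calc (1 - ε) * (p * D.q p) ≤ (1 - s ^ 2) * (1 - X) * (p * D.q p) := by gcongr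
    _ = _ := by ring

/-- There is a universal constant `C` such that for every `ε ∈ (0,1)`, every MHR value
distribution `D`, and every `m ≥ C ε^{-3/2} log(1/ε)`, the `(1/e)`-guarded empirical
reserve computed from `m` i.i.d. samples from `D` has expected revenue at least
`(1 - ε)` times the optimal revenue `R* = max_p p (1 - F p)`. -/
theorem mhr_sample_complexity_upper_bound :
    ∃ C : ℝ, 0 < C ∧
      ∀ ε : ℝ, ε ∈ Ioo (0:ℝ) 1 →
      ∀ D : ValueDist, D.IsMHR →
      ∀ m : ℕ, C * ε ^ (-(3:ℝ)/2) * Real.log (1/ε) ≤ (m : ℝ) →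
      ∀ ER : (Fin m → ℝ) → ℝ, Measurable ER →
        (∀ s, IsGuardedEmpiricalReserve (Real.exp 1)⁻¹ s (ER s)) →
      ∀ r : ℝ,
        (1 - ε) * (r * (1 - D.F r)) ≤
          ∫ s : Fin m → ℝ, ER s * (1 - D.F (ER s)) ∂(Measure.pi fun _ : Fin m => D.μ) := by
  
  -- constants
  set M1 : ℕ := ⌈600000 * (1 / 2 : ℝ) ^ (-(3:ℝ)/2) * Real.log (1/(1/2))⌉₊ with hM1
  set c0 : ℝ := 1 / 6 * (1 / 6) ^ M1 with hc0
  have hc0pos : 0 < c0 := by positivity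
  refine ⟨600000 + M1 / c0, by positivity, ?_⟩
  rintro ε ⟨hε0, hε1⟩ D hM m hm ER hER hg r
  obtain ⟨p, hp⟩ := D.exists_opt hM
  have hR0 : 0 ≤ p * D.q p := mul_nonneg hp.1.le (D.q_nonneg _)
  have hlog : 0 < Real.log (1 / ε) := Real.log_pos (by rw [lt_div_iff₀ hε0]; linarith)
  have hopt : (1 - ε) * (r * (1 - D.F r)) ≤ (1 - ε) * (p * D.q p) :=
    mul_le_mul_of_nonneg_left (hp.2.2 r) (by linarith)
  refine hopt.trans ?_
  rcases lt_or_ge m M1 with hmM | hmM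
  · refine le_trans ?_ (small_bound hM hp hER hg)
    have h1 : 1 - ε ≤ Real.log (1 / ε) := by
      have := Real.one_sub_inv_le_log_of_pos (show 0 < 1 / ε by positivity)
      simpa using this
    have h2 : 1 ≤ ε ^ (-(3:ℝ)/2) :=
      Real.one_le_rpow_of_pos_of_le_one_of_nonpos hε0 hε1.le (by norm_num)
    have h3 : (M1 / c0) * (1 - ε) ≤ M1 := by
      have hmM' : (m : ℝ) ≤ M1 := by exact_mod_cast hmM.le
      have : (M1 / c0) * (1 - ε) ≤ (600000 + M1 / c0) * ε ^ (-(3:ℝ)/2) * Real.log (1/ε) := by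
        calc (M1 / c0) * (1 - ε) ≤ (600000 + M1 / c0) * 1 * Real.log (1/ε) := by
              rw [mul_one]
              apply mul_le_mul (by linarith) h1 (by linarith) (by positivity)
          _ ≤ _ := by gcongr
      linarith
    have hM1pos : (0:ℝ) < M1 := by
      exact_mod_cast lt_of_le_of_lt (Nat.zero_le m) hmM
    have h4 : 1 - ε ≤ c0 := by
      rw [div_mul_eq_mul_div, div_le_iff₀ hc0pos] at h3
      exact le_of_mul_le_mul_left h3 hM1pos
    have h5 : (1 / 6 : ℝ) ^ M1 ≤ (1 / 6) ^ m :=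
      pow_le_pow_of_le_one (by norm_num) (by norm_num) hmM.le
    calc (1 - ε) * (p * D.q p) ≤ (1 / 6 * (1 / 6) ^ m) * (p * D.q p) := by
          refine mul_le_mul_of_nonneg_right (h4.trans ?_) hR0
          rw [hc0]; gcongr
      _ = _ := by ring
  · rcases le_or_gt ε (1 / 2) with hε2 | hε2
    · refine main_eps hM hp hER hg hε0 hε2 (le_trans ?_ hm)
      gcongr
      have : 0 ≤ M1 / c0 := by positivity
      linarith
    · refine le_trans ?_ (main_eps hM hp hER hg (ε := 1 / 2) (by norm_num) le_rfl ?_)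
      · exact mul_le_mul_of_nonneg_right (by linarith) hR0
      · exact (Nat.le_ceil _).trans (Nat.cast_le.2 hmM)
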